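/- arXiv:1703.08890 — 6 statements merged into one kernel-verified Lean document; each statement's English description precedes it below -/
import Mathlib

section
/- There exists a finite group G of order 2^7 = 128 and an irreducible complex character χ of G with Frobenius–Schur indicator ν₂(χ) = +1, together with an irreducible complex character φ of G such that φ is a constituent of χ·χ (i.e., the inner product ⟨χ·χ, φ⟩ ≥ 1) and ν₂(φ) = −1. -/
open scoped ComplexOrder

/-- The quaternion group of order 8; `⟨a, b, c⟩` stands for `j ^ b * i ^ a * (-1) ^ c`. -/
@[ext]
structure QuatEight where
  a : ZMod 2
  b : ZMod 2
  c : ZMod 2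
  deriving DecidableEq, Fintype

namespace QuatEight

instance : Mul QuatEight :=
  ⟨fun x y => ⟨x.a + y.a, x.b + y.b, x.c + y.c + x.a * y.a + x.b * y.b + x.a * y.b⟩⟩

instance : One QuatEight := ⟨⟨0, 0, 0⟩⟩

instance : Inv QuatEight := ⟨fun x => ⟨x.a, x.b, x.c + x.a + x.b + x.a * x.b⟩⟩

instance : Group QuatEight :=
  Group.ofLeftAxioms (by decide +kernel) (by decide +kernel) (by decide +kernel)

/-- The faithful two-dimensional representation of the quaternion group. -/
def toMatrix : QuatEight →* Matrix (Fin 2) (Fin 2) GaussianInt where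
  toFun x := (-1) ^ x.c.val * !![0, 1; -1, 0] ^ x.b.val * !![⟨0, 1⟩, 0; 0, ⟨0, -1⟩] ^ x.a.val
  map_one' := by decide +kernel
  map_mul' := by decide +kernel

end QuatEight

/-- An affine function `x ↦ k + u * x.a + v * x.b + w * x.c` on the quaternion group. -/
@[ext]
structure AffineFun where
  k : ZMod 2
  u : ZMod 2
  v : ZMod 2
  w : ZMod 2
  deriving DecidableEq, Fintype

namespace AffineFun

/-- The value of an affine function at a point. -/
def eval (f : AffineFun) (x : QuatEight) : ZMod 2 := f.k + f.u * x.a + f.v * x.b + f.w * x.c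

instance : Add AffineFun := ⟨fun f g => ⟨f.k + g.k, f.u + g.u, f.v + g.v, f.w + g.w⟩⟩

instance : Zero AffineFun := ⟨⟨0, 0, 0, 0⟩⟩

/-- The right translate `x ↦ f (x * q)`. -/
def translate (f : AffineFun) (q : QuatEight) : AffineFun :=
  ⟨f.k + f.u * q.a + f.v * q.b + f.w * q.c, f.u + f.w * (q.a + q.b), f.v + f.w * q.b, f.w⟩

lemma eval_add (f g : AffineFun) (x : QuatEight) : (f + g).eval x = f.eval x + g.eval x := by
  change (f.k + g.k) + (f.u + g.u) * x.a + (f.v + g.v) * x.b + (f.w + g.w) * x.c = _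
  simp only [eval]
  ring

lemma eval_translate (f : AffineFun) (q x : QuatEight) :
    (f.translate q).eval x = f.eval (x * q) := by
  change _ = f.k + f.u * (x.a + q.a) + f.v * (x.b + q.b) +
    f.w * (x.c + q.c + x.a * q.a + x.b * q.b + x.a * q.b)
  simp only [eval, translate]
  ring

lemma eval_injective : Function.Injective eval := by decide +kernel

end AffineFun

/-- The semidirect product of the affine functions on the quaternion group by the quaternion
group, which acts by right translation. -/
@[ext]
structure AffineQuat where
  q : QuatEight
  f : AffineFun
  deriving DecidableEq, Fintype

namespace AffineQuat

instance : Mul AffineQuat := ⟨fun g h => ⟨g.q * h.q, g.f + h.f.translate g.q⟩⟩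

instance : One AffineQuat := ⟨⟨1, 0⟩⟩

instance : Inv AffineQuat := ⟨fun g => ⟨g.q⁻¹, g.f.translate g.q⁻¹⟩⟩

lemma q_mul (g h : AffineQuat) : (g * h).q = g.q * h.q := rfl

lemma f_mul (g h : AffineQuat) : (g * h).f = g.f + h.f.translate g.q := rfl

instance : Group AffineQuat :=
  Group.ofLeftAxioms
    (fun g h k => by
      refine AffineQuat.ext (mul_assoc _ _ _) (AffineFun.eval_injective (funext fun x => ?_))
      simp only [f_mul, q_mul, AffineFun.eval_add, AffineFun.eval_translate, mul_assoc, add_assoc])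
    (by decide +kernel) (by decide +kernel)

/-- The sign `(-1) ^ e` of a class modulo 2. -/
def sign (e : ZMod 2) : GaussianInt := if e = 0 then 1 else -1

lemma sign_add : ∀ d e, sign (d + e) = sign d * sign e := by decide +kernel

/-- The monomial representation of dimension 8 on the functions on the quaternion group. -/
def monomial : AffineQuat →* Matrix QuatEight QuatEight GaussianInt where
  toFun g := .of fun x y => if x * g.q = y then sign (g.f.eval x) else 0
  map_one' := by decide +kernel
  map_mul' g h := by
    ext1 x z
    rw [Matrix.mul_apply, Finset.sum_eq_single (x * g.q) (by simp +contextual [eq_comm]) (by simp)]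
    simp [q_mul, f_mul, AffineFun.eval_add, AffineFun.eval_translate, sign_add, mul_assoc]

/-- The projection onto the quaternion group. -/
def proj : AffineQuat →* QuatEight where
  toFun := q
  map_one' := rfl
  map_mul' _ _ := rfl

lemma trace_monomial : ∀ g : AffineQuat, (monomial g).trace =
    if g.q = 1 ∧ g.f.u = 0 ∧ g.f.v = 0 ∧ g.f.w = 0 then 8 * sign g.f.k else 0 := by
  decide +kernel

lemma trace_toMatrix : ∀ x : QuatEight, x.toMatrix.trace =
    if x.a = 0 ∧ x.b = 0 then 2 * sign x.c else 0 := by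
  decide +kernel

end AffineQuat

section Character

variable {G : Type} {n : Type} [Fintype n] [DecidableEq n]

/-- The complex representation given by a group of Gaussian integer matrices. -/
noncomputable def FDRep.ofGaussian [Monoid G] (M : G →* Matrix n n GaussianInt) : FDRep ℂ G :=
  FDRep.of ((Matrix.toLinAlgEquiv' (R := ℂ) (n := n)).toMonoidHom.comp
    ((GaussianInt.toComplex.mapMatrix : _ →+* Matrix n n ℂ).toMonoidHom.comp M))

lemma FDRep.character_ofGaussian [Monoid G] (M : G →* Matrix n n GaussianInt) (g : G) :
    (FDRep.ofGaussian M).character g = GaussianInt.toComplex (M g).trace := by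
  have h : (FDRep.ofGaussian M).character g =
      LinearMap.trace ℂ (n → ℂ) (Matrix.toLin' (GaussianInt.toComplex.mapMatrix (M g))) := rfl
  rw [h, Matrix.trace_toLin'_eq]
  simp [Matrix.trace]

lemma FDRep.simple_ofGaussian [Group G] [Fintype G] (M : G →* Matrix n n GaussianInt)
    (h : ∑ g, (M g).trace * (M g⁻¹).trace = Fintype.card G) :
    CategoryTheory.Simple (FDRep.ofGaussian M) := by
  rw [FDRep.simple_iff_char_is_norm_one]
  simp only [FDRep.character_ofGaussian, ← map_mul, ← map_sum, h]
  simp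

end Character

open AffineQuat in
/-- There exists a finite group `G` of order `2^7 = 128`, an irreducible complex character `χ`
of `G` with Frobenius–Schur indicator `ν₂(χ) = +1`, and an irreducible complex character `φ`
of `G` which is a constituent of `χ · χ` and has `ν₂(φ) = -1`. -/
theorem positivity_counterexample :
    ∃ (G : Type) (_ : Group G) (_ : Fintype G),
      Fintype.card G = 128 ∧
      ∃ V W : FDRep ℂ G,
        CategoryTheory.Simple V ∧ CategoryTheory.Simple W ∧
        -- ν₂(χ) = +1
        (Fintype.card G : ℂ)⁻¹ * (∑ g : G, V.character (g ^ 2)) = 1 ∧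
        -- ν₂(φ) = -1
        (Fintype.card G : ℂ)⁻¹ * (∑ g : G, W.character (g ^ 2)) = -1 ∧
        -- ⟨χ·χ, φ⟩ ≥ 1
        1 ≤ (Fintype.card G : ℂ)⁻¹ *
            ∑ g : G, V.character g * V.character g * (starRingEnd ℂ) (W.character g) := by
  have card : Fintype.card AffineQuat = 128 := by decide +kernel
  refine ⟨AffineQuat, inferInstance, inferInstance, card, FDRep.ofGaussian monomial,
    FDRep.ofGaussian (QuatEight.toMatrix.comp proj), FDRep.simple_ofGaussian _ ?_,
    FDRep.simple_ofGaussian _ ?_, ?_, ?_, ?_⟩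
  · simp only [trace_monomial, card]
    decide +kernel
  · simp only [MonoidHom.comp_apply, trace_toMatrix, card]
    decide +kernel
  · have h : ∑ g : AffineQuat, (monomial (g ^ 2)).trace = 128 := by
      simp only [trace_monomial]
      decide +kernel
    simp only [FDRep.character_ofGaussian, ← map_sum, h, card,
      map_ofNat GaussianInt.toComplex 128]
    norm_num
  · have h : ∑ g : AffineQuat, (proj (g ^ 2)).toMatrix.trace = -128 := by
      simp only [trace_toMatrix]
      decide +kernel
    simp only [FDRep.character_ofGaussian, MonoidHom.comp_apply, ← map_sum, h, card, map_neg,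
      map_ofNat GaussianInt.toComplex 128]
    norm_num
  · have h : ∑ g : AffineQuat, (monomial g).trace * (monomial g).trace *
        star (proj g).toMatrix.trace = 256 := by
      simp only [trace_monomial, trace_toMatrix]
      decide +kernel
    simp only [FDRep.character_ofGaussian, MonoidHom.comp_apply, ← GaussianInt.toComplex_star,
      ← map_mul, ← map_sum, h, card, map_ofNat GaussianInt.toComplex 256]
    norm_num
end

section
/- Let G be a finite group, H a normal subgroup of G, and λ : H → ℂˣ a group homomorphism (a degree-one complex character of H). If for every x ∈ G with x ∉ H there exists h ∈ H such that λ([h, x]) ≠ 1, then the induced character Ind_H^G λ is an irreducible character of G. -/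
open Classical in
/-- The induced character `Ind_H^G λ` of a degree-one character `λ : H → ℂˣ`,
given by `(Ind_H^G λ)(g) = |H|⁻¹ · Σ_{t ∈ G, t⁻¹gt ∈ H} λ(t⁻¹gt)`. -/
noncomputable def inducedChar {G : Type*} [Group G] [Fintype G] (H : Subgroup G)
    (lam : H →* ℂˣ) : G → ℂ := fun g =>
  (Nat.card H : ℂ)⁻¹ * ∑ t : G, if h : t⁻¹ * g * t ∈ H then (lam ⟨t⁻¹ * g * t, h⟩ : ℂ) else 0

/-- The one-dimensional representation on `ℂ` afforded by a degree-one character. -/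
noncomputable def linearCharRep {M : Type*} [Monoid M] (lam : M →* ℂˣ) : Representation ℂ M ℂ :=
  (Algebra.lmul ℂ ℂ : ℂ →* Module.End ℂ ℂ).comp ((Units.coeHom ℂ).comp lam)

theorem mem_coindV_linearCharRep_iff {G : Type*} [Group G] (H : Subgroup G)
    (lam : H →* ℂˣ) (f : G → ℂ) :
    f ∈ Representation.coindV H.subtype (linearCharRep lam) ↔
      ∀ (h : H) (x : G), f (h * x) = lam h * f x :=
  Iff.rfl

/-- The representation `Ind_H^G λ`, realised by right translation on the functions `f : G → ℂ` with
`f (h * x) = λ h * f x`. -/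
noncomputable def monomialRep {G : Type*} [Group G] (H : Subgroup G) (lam : H →* ℂˣ) :
    Representation ℂ G (Representation.coindV H.subtype (linearCharRep lam)) :=
  Representation.coind H.subtype (linearCharRep lam)

/-- The operator on functions `G → ℂ` obtained by projecting onto the functions `f` with
`f (h * x) = λ h * f x` and then translating by `g`. -/
noncomputable def translateProj {G : Type*} [Group G] [Fintype G] (H : Subgroup G) [Fintype H]
    (lam : H →* ℂˣ) (g : G) : (G → ℂ) →ₗ[ℂ] (G → ℂ) where
  toFun f x := (Nat.card H : ℂ)⁻¹ * ∑ h : H, ((lam h)⁻¹ : ℂˣ) * f (h * (x * g))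
  map_add' f f' := by
    ext x; simp [mul_add, Finset.sum_add_distrib]
  map_smul' c f := by
    ext x
    simp only [Pi.smul_apply, smul_eq_mul, RingHom.id_apply, Finset.mul_sum]
    exact Finset.sum_congr rfl fun _ _ ↦ by ring

section

variable {G : Type*} [Group G] [Fintype G] (H : Subgroup G) (lam : H →* ℂˣ)

theorem translateProj_mem_coindV [Fintype H] (g : G) (f : G → ℂ) :
    translateProj H lam g f ∈ Representation.coindV H.subtype (linearCharRep lam) := by
  rw [mem_coindV_linearCharRep_iff]
  intro k x
  simp only [translateProj, LinearMap.coe_mk, AddHom.coe_mk]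
  rw [mul_left_comm, Finset.mul_sum (a := (lam k : ℂ))]
  congr 1
  refine Fintype.sum_equiv (Equiv.mulRight k) _ _ fun h ↦ ?_
  simp [mul_assoc]

theorem translateProj_apply_of_mem [Fintype H] (g : G) {f : G → ℂ}
    (hf : f ∈ Representation.coindV H.subtype (linearCharRep lam)) (x : G) :
    translateProj H lam g f x = f (x * g) := by
  rw [mem_coindV_linearCharRep_iff] at hf
  simp [translateProj, hf]

theorem trace_translateProj [Fintype H] (g : G) :
    LinearMap.trace ℂ (G → ℂ) (translateProj H lam g) = inducedChar H lam g := by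
  classical
  rw [LinearMap.trace_eq_matrix_trace ℂ (Pi.basisFun ℂ G), Matrix.trace, inducedChar,
    Finset.mul_sum]
  refine Fintype.sum_equiv (Equiv.inv G) _ _ fun x ↦ ?_
  simp only [Matrix.diag_apply, LinearMap.toMatrix_apply, Pi.basisFun_apply, Pi.basisFun_repr,
    translateProj, LinearMap.coe_mk, AddHom.coe_mk, Equiv.inv_apply, inv_inv]
  congr 1
  have hiff (h : H) : (h : G) * (x * g) = x ↔ (h : G)⁻¹ = x * g * x⁻¹ := by
    rw [inv_eq_iff_eq_inv, ← eq_mul_inv_iff_mul_eq]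
    simp [mul_assoc]
  split_ifs with hx
  · rw [Finset.sum_eq_single (⟨x * g * x⁻¹, hx⟩⁻¹ : H)]
    · simp [mul_assoc]
    · intro h _ hne
      rw [Pi.single_eq_of_ne, mul_zero]
      rw [Ne, hiff]
      exact fun hh ↦ hne (inv_eq_iff_eq_inv.mp (Subtype.ext hh))
    · simp
  · refine Finset.sum_eq_zero fun h _ ↦ ?_
    rw [Pi.single_eq_of_ne, mul_zero]
    rw [Ne, hiff]
    exact fun hh ↦ hx (hh ▸ inv_mem h.2)

theorem character_monomialRep (g : G) :
    (monomialRep H lam).character g = inducedChar H lam g := by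
  classical
  rw [← trace_translateProj, ← LinearMap.trace_restrict_eq_of_forall_mem _ _
    (translateProj_mem_coindV H lam g)]
  rw [Representation.character]
  congr 1
  ext f x
  exact (translateProj_apply_of_mem H lam g f.2 x).symm

variable [H.Normal]

theorem inducedChar_eq_zero_of_notMem {g : G} (hg : g ∉ H) : inducedChar H lam g = 0 := by
  rw [inducedChar, Finset.sum_eq_zero, mul_zero]
  intro t _
  rw [dif_neg]
  intro h
  exact hg (by simpa [mul_assoc] using ‹H.Normal›.conj_mem _ h t)

theorem inducedChar_apply_coe (g : H) :
    inducedChar H lam g = (Nat.card H : ℂ)⁻¹ * ∑ t : G, (lam (MulAut.conjNormal t⁻¹ g) : ℂ) := by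
  rw [inducedChar]
  congr 1
  refine Finset.sum_congr rfl fun t _ ↦ ?_
  have ht : t⁻¹ * g * t = MulAut.conjNormal t⁻¹ g := by simp
  rw [dif_pos (ht ▸ SetLike.coe_mem _)]
  congr 2
  exact Subtype.ext ht

open Classical in
/-- Orthogonality of the `G`-conjugates of `λ` when `λ` has inertia group `H`. -/
theorem sum_conj_mul_conj_inv
    (hlam : ∀ x : G, x ∉ H → ∃ h : H, lam h ≠ lam (MulAut.conjNormal x⁻¹ h)) (s t : G) :
    ∑ g : H, (lam (MulAut.conjNormal s⁻¹ g) : ℂ) * lam (MulAut.conjNormal t⁻¹ g⁻¹) =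
      if s⁻¹ * t ∈ H then (Nat.card H : ℂ) else 0 := by
  let μ : H →* ℂ := (Units.coeHom ℂ).comp
    (lam.comp (MulAut.conjNormal s⁻¹ : MulAut H).toMonoidHom /
      lam.comp (MulAut.conjNormal t⁻¹ : MulAut H).toMonoidHom)
  have hμ (g : H) : μ g =
      (lam (MulAut.conjNormal s⁻¹ g) : ℂ) * lam (MulAut.conjNormal t⁻¹ g⁻¹) := by
    simp [μ, div_eq_mul_inv]
  have hμ_eq_one (g : H) :
      μ g = 1 ↔ lam (MulAut.conjNormal s⁻¹ g) = lam (MulAut.conjNormal t⁻¹ g) := by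
    rw [hμ, map_inv (MulAut.conjNormal t⁻¹), map_inv lam, ← Units.val_mul, Units.val_eq_one,
      mul_inv_eq_one]
  simp_rw [← hμ, sum_hom_units, Nat.card_eq_fintype_card]
  have htriv : μ = 1 ↔ s⁻¹ * t ∈ H := by
    constructor
    · intro h1
      by_contra hst
      obtain ⟨h, hh⟩ := hlam _ hst
      apply hh
      have h2 := (hμ_eq_one (MulAut.conjNormal s h)).mp (by rw [h1, MonoidHom.one_apply])
      rw [← MulAut.mul_apply, ← MulAut.mul_apply, ← map_mul, ← map_mul] at h2
      simpa using h2
    · intro hst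
      ext g
      have hconj : MulAut.conjNormal t⁻¹ g =
          (⟨s⁻¹ * t, hst⟩ : H)⁻¹ * MulAut.conjNormal s⁻¹ g * ⟨s⁻¹ * t, hst⟩ := by
        ext; simp [mul_assoc]
      rw [MonoidHom.one_apply, hμ_eq_one, hconj, map_mul, map_mul, map_inv lam,
        mul_right_comm, inv_mul_cancel, one_mul]
  simp [htriv]

theorem sum_inducedChar_mul_inv
    (hlam : ∀ x : G, x ∉ H → ∃ h : H, lam h ≠ lam (MulAut.conjNormal x⁻¹ h)) :
    ∑ g : G, inducedChar H lam g * inducedChar H lam g⁻¹ = Nat.card G := by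
  classical
  have hH0 : (Nat.card H : ℂ) ≠ 0 := Nat.cast_ne_zero.mpr Nat.card_pos.ne'
  have hcoset (s : G) :
      ∑ t : G, (if s⁻¹ * t ∈ H then (Nat.card H : ℂ) else 0) = Nat.card H * Nat.card H := by
    rw [Fintype.sum_equiv (Equiv.mulLeft s⁻¹) (fun t ↦ if s⁻¹ * t ∈ H then (Nat.card H : ℂ) else 0)
      (fun t ↦ if t ∈ H then (Nat.card H : ℂ) else 0) fun _ ↦ rfl,
      ← Finset.sum_filter, Finset.sum_const, nsmul_eq_mul, Nat.card_eq_fintype_card,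
      Fintype.card_subtype]
  calc ∑ g : G, inducedChar H lam g * inducedChar H lam g⁻¹
      = ∑ g : H, inducedChar H lam g * inducedChar H lam (g⁻¹ : H) := by
        rw [← Finset.sum_subset (Finset.subset_univ (Finset.univ.filter (· ∈ H)))]
        · exact Finset.sum_subtype _ (by simp) _
        · intro g _ hg
          rw [inducedChar_eq_zero_of_notMem H lam (by simpa using hg), zero_mul]
    _ = ((Nat.card H : ℂ)⁻¹ * (Nat.card H : ℂ)⁻¹) * ∑ s : G, ∑ t : G, ∑ g : H,
          (lam (MulAut.conjNormal s⁻¹ g) : ℂ) * lam (MulAut.conjNormal t⁻¹ g⁻¹) := by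
        simp_rw [inducedChar_apply_coe, mul_mul_mul_comm, ← Finset.mul_sum, Finset.sum_mul_sum]
        rw [Finset.sum_comm]
        congr 1
        exact Finset.sum_congr rfl fun s _ ↦ Finset.sum_comm
    _ = Nat.card G := by
        simp_rw [sum_conj_mul_conj_inv H lam hlam, hcoset]
        rw [Finset.sum_const, nsmul_eq_mul, Finset.card_univ, ← Nat.card_eq_fintype_card]
        field_simp

end

/-- If `H ⊴ G` and `λ : H → ℂˣ` is a degree-one character such that for every `x ∈ G \ H`
there is `h ∈ H` with `λ([h,x]) ≠ 1`, then `Ind_H^G λ` is an irreducible character of `G`. -/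
theorem inducedChar_irreducible (G : Type) [Group G] [Fintype G] (H : Subgroup G)
    (hH : H.Normal) (lam : H →* ℂˣ)
    (hlam : ∀ x : G, x ∉ H → ∃ h : H, lam ⟨(h : G)⁻¹ * x⁻¹ * h * x,
      by simpa [mul_assoc] using mul_mem (inv_mem h.2) (hH.conj_mem' h h.2 x)⟩ ≠ 1) :
    ∃ V : FDRep ℂ G, CategoryTheory.Simple V ∧ V.character = inducedChar H lam := by
  refine ⟨FDRep.of (monomialRep H lam), ?_, funext (character_monomialRep H lam)⟩
  rw [FDRep.simple_iff_char_is_norm_one]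
  have hchar : (FDRep.of (monomialRep H lam)).character = inducedChar H lam :=
    funext (character_monomialRep H lam)
  rw [hchar]
  refine sum_inducedChar_mul_inv H lam fun x hx ↦ ?_
  obtain ⟨h, hh⟩ := hlam x hx
  refine ⟨h, fun heq ↦ hh ?_⟩
  have hmul : (⟨(h : G)⁻¹ * x⁻¹ * h * x,
      by simpa [mul_assoc] using mul_mem (inv_mem h.2) (hH.conj_mem' h h.2 x)⟩ : H) =
      h⁻¹ * MulAut.conjNormal x⁻¹ h := by
    ext; simp [mul_assoc]
  rw [hmul, map_mul, map_inv, heq, inv_mul_cancel]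
end

section
/- Let ρ : Q₈ → GL₄(𝔽₂) be an injective group homomorphism and let z be the unique element of order 2 of Q₈. Then the fixed-point subspace {v ∈ 𝔽₂⁴ : ρ(z)·v = v} has dimension 3 over 𝔽₂; equivalently, the image of the linear map ρ(z) − 1 on 𝔽₂⁴ has dimension 1 (so the corresponding commutator subgroup [H, z], where H = (ℤ/2)⁴, has order 2). -/
theorem Matrix.eq_zero_or_eq_zero_or_add_eq_zero_of_commute_of_sq_eq_zero
    (M N : Matrix (Fin 2) (Fin 2) (ZMod 2)) (hM : M * M = 0) (hN : N * N = 0)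
    (hMN : M * N = N * M) : M = 0 ∨ N = 0 ∨ M + N = 0 := by
  revert M N
  decide

section

variable {V : Type*} [AddCommGroup V] [Module (ZMod 2) V]

theorem LinearMap.eq_zero_or_eq_zero_or_add_eq_zero_of_commute_of_sq_eq_zero
    (hV : Module.finrank (ZMod 2) V = 2) (f g : Module.End (ZMod 2) V)
    (hf : f * f = 0) (hg : g * g = 0) (hfg : f * g = g * f) :
    f = 0 ∨ g = 0 ∨ f + g = 0 := by
  have : FiniteDimensional (ZMod 2) V := Module.finite_of_finrank_eq_succ hV
  let e := LinearMap.toMatrixAlgEquiv (Module.finBasisOfFinrankEq (ZMod 2) V hV)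
  have h := Matrix.eq_zero_or_eq_zero_or_add_eq_zero_of_commute_of_sq_eq_zero (e f) (e g)
    (by rw [← map_mul, hf, map_zero]) (by rw [← map_mul, hg, map_zero])
    (by rw [← map_mul, hfg, map_mul])
  simpa only [← map_add, EmbeddingLike.map_eq_zero_iff] using h

theorem Module.End.add_self_eq_zero_of_zmod_two (f : Module.End (ZMod 2) V) : f + f = 0 := by
  rw [← two_smul (ZMod 2) f, show (2 : ZMod 2) = 0 from rfl, zero_smul]

theorem Module.End.sq_eq_zero_of_ker_le_range {d n : Module.End (ZMod 2) V}
    (hnd : n * d = 0) (hdn : d * n = 0) (h : LinearMap.ker n ≤ LinearMap.range n) :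
    d * d = 0 := by
  ext v
  obtain ⟨w, hw⟩ := h (show d v ∈ LinearMap.ker n from LinearMap.congr_fun hnd v)
  rw [Module.End.mul_apply, ← hw]
  exact LinearMap.congr_fun hdn w

/-- Commuting square-zero maps on the plane `range n` over `𝔽₂`. -/
theorem Module.End.mul_eq_zero_of_finrank_range_eq_two {n a b : Module.End (ZMod 2) V}
    (hn : Module.finrank (ZMod 2) (LinearMap.range n) = 2)
    (han : a * n = n * a) (hbn : b * n = n * b)
    (ha : a * a * n = 0) (hb : b * b * n = 0) (hab : a * b * n = b * a * n) :
    a * n = 0 ∨ b * n = 0 ∨ (a + b) * n = 0 := by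
  have stable {c : Module.End (ZMod 2) V} (hc : c * n = n * c) :
      ∀ x ∈ LinearMap.range n, c x ∈ LinearMap.range n := by
    rintro _ ⟨v, rfl⟩
    exact ⟨c v, (LinearMap.congr_fun hc v).symm⟩
  have h := LinearMap.eq_zero_or_eq_zero_or_add_eq_zero_of_commute_of_sq_eq_zero hn
    (a.restrict (stable han)) (b.restrict (stable hbn))
    (by ext ⟨_, v, rfl⟩; exact LinearMap.congr_fun ha v)
    (by ext ⟨_, v, rfl⟩; exact LinearMap.congr_fun hb v)
    (by ext ⟨_, v, rfl⟩; exact LinearMap.congr_fun hab v)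
  refine h.imp (fun h ↦ ?_) (Or.imp (fun h ↦ ?_) fun h ↦ ?_) <;>
  · ext v
    exact congrArg Subtype.val (LinearMap.congr_fun h ⟨n v, v, rfl⟩)

/-- `A` and `B` satisfy the relations of the standard generators of `Q₈`. -/
theorem Module.End.finrank_of_quaternion_relations
    (hV : Module.finrank (ZMod 2) V = 4) {A B : Module.End (ZMod 2) V}
    (hA4 : A * A * (A * A) = 1) (hBA : B * B = A * A) (hAB : A * B = A * A * (B * A))
    (hA : A * A ≠ 1) :
    Module.finrank (ZMod 2) (LinearMap.ker (A * A - 1)) = 3 ∧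
      Module.finrank (ZMod 2) (LinearMap.range (A * A - 1)) = 1 := by
  have : FiniteDimensional (ZMod 2) V := Module.finite_of_finrank_eq_succ hV
  have h2 := Module.End.add_self_eq_zero_of_zmod_two (V := V)
  have hsub : A * A - 1 = A * A + 1 := by
    rw [sub_eq_add_neg, neg_eq_of_add_eq_zero_left (h2 1)]
  rw [hsub]
  obtain ⟨n, hn⟩ : ∃ n, n = A * A + 1 := ⟨_, rfl⟩
  rw [← hn]
  have hn0 : n ≠ 0 := by rwa [hn, ← hsub, sub_ne_zero]
  have hnn : n * n = 0 := by
    have : n * n = A * A * (A * A) + 1 + (A * A + A * A) := by rw [hn]; noncomm_ring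
    rw [this, hA4, h2, h2, add_zero]
  have hAn : A * n = n * A := by rw [hn]; noncomm_ring
  have hBn : B * n = n * B := by rw [hn, ← hBA]; noncomm_ring
  have haa : (A + 1) * (A + 1) = n := by
    have : (A + 1) * (A + 1) = A * A + 1 + (A + A) := by noncomm_ring
    rw [this, h2, add_zero, hn]
  have hbb : (B + 1) * (B + 1) = n := by
    have : (B + 1) * (B + 1) = B * B + 1 + (B + B) := by noncomm_ring
    rw [this, h2, add_zero, hn, hBA]
  have hcomm : A * B + B * A = n * (B * A) := by rw [hAB, hn]; noncomm_ring
  have han : (A + 1) * n = n * (A + 1) := by rw [add_mul, mul_add, hAn, one_mul, mul_one]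
  have hbn : (B + 1) * n = n * (B + 1) := by rw [add_mul, mul_add, hBn, one_mul, mul_one]
  have hd : A + 1 + (B + 1) = A + B := by
    rw [add_add_add_comm, h2, add_zero]
  have hdd : (A + B) * (A + B) = n * (B * A) := by
    have : (A + B) * (A + B) = A * A + B * B + (A * B + B * A) := by noncomm_ring
    rw [this, hcomm, hBA, h2, zero_add]
  have hBAn : B * A * n = n * (B * A) := by rw [mul_assoc, hAn, ← mul_assoc, hBn, mul_assoc]
  have hab : (A + 1) * (B + 1) * n = (B + 1) * (A + 1) * n := by
    rw [← sub_eq_zero, ← sub_mul]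
    have : (A + 1) * (B + 1) - (B + 1) * (A + 1) = A * B + B * A - (B * A + B * A) := by
      noncomm_ring
    rw [this, h2, sub_zero, hcomm, mul_assoc, hBAn, ← mul_assoc, hnn, zero_mul]
  have hrank := LinearMap.finrank_range_add_finrank_ker n
  have hle : LinearMap.range n ≤ LinearMap.ker n := LinearMap.range_le_ker_iff.mpr hnn
  have hle' := Submodule.finrank_mono hle
  have hpos : Module.finrank (ZMod 2) (LinearMap.range n) ≠ 0 := by
    rwa [Ne, Submodule.finrank_eq_zero, LinearMap.range_eq_bot]
  have hne : Module.finrank (ZMod 2) (LinearMap.range n) ≠ 2 := by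
    intro hr
    have hker : LinearMap.ker n ≤ LinearMap.range n :=
      (Submodule.eq_of_le_of_finrank_eq hle (by omega)).ge
    rcases Module.End.mul_eq_zero_of_finrank_range_eq_two hr han hbn (by rw [haa, hnn])
      (by rw [hbb, hnn]) hab with h | h | h
    · exact hn0 (haa ▸ Module.End.sq_eq_zero_of_ker_le_range (han ▸ h) h hker)
    · exact hn0 (hbb ▸ Module.End.sq_eq_zero_of_ker_le_range (hbn ▸ h) h hker)
    · rw [hd] at h
      have hnd : n * (A + B) = 0 := by rw [← h, mul_add, add_mul, hAn, hBn]
      have h0 := hdd ▸ Module.End.sq_eq_zero_of_ker_le_range hnd h hker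
      have hinv : B * A * (A * (A * A) * (B * (A * A))) = 1 := by
        calc _ = B * (A * A * (A * A)) * B * (A * A) := by noncomm_ring
          _ = 1 := by rw [hA4, mul_one, hBA, hA4]
      apply hn0
      rw [← mul_one n, ← hinv, ← mul_assoc, h0, zero_mul]
  omega

end

/-- If `ρ : Q₈ → GL₄(𝔽₂)` is injective and `z` is the unique element of order 2 of `Q₈`,
then the fixed space of `ρ(z)` on `𝔽₂⁴` has dimension 3; equivalently, the image of
`ρ(z) - 1` has dimension 1 (so the commutator subgroup `[H, z]` has order 2). -/
theorem fixed_space_of_central_involution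
    (ρ : QuaternionGroup 2 →* GL (Fin 4) (ZMod 2)) (hρ : Function.Injective ρ)
    (z : QuaternionGroup 2) (hz : orderOf z = 2) :
    Module.finrank (ZMod 2)
      (LinearMap.ker (Matrix.mulVecLin (ρ z : Matrix (Fin 4) (Fin 4) (ZMod 2)) -
        LinearMap.id)) = 3 ∧
    Module.finrank (ZMod 2)
      (LinearMap.range (Matrix.mulVecLin (ρ z : Matrix (Fin 4) (Fin 4) (ZMod 2)) -
        LinearMap.id)) = 1 := by
  have hz' : z = .a 1 * .a 1 := by
    have h1 : z ^ 2 = 1 := orderOf_dvd_iff_pow_eq_one.mp hz.dvd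
    have h2 : z ≠ 1 := by rintro rfl; simp at hz
    clear hz
    revert z
    decide
  let φ : QuaternionGroup 2 →* Module.End (ZMod 2) (Fin 4 → ZMod 2) :=
    (Matrix.toLinAlgEquiv' : _ ≃ₐ[ZMod 2] _).toMonoidHom.comp ((Units.coeHom _).comp ρ)
  have hφ : Function.Injective φ :=
    Matrix.toLinAlgEquiv'.injective.comp (Units.val_injective.comp hρ)
  have hφz : Matrix.mulVecLin (ρ z : Matrix (Fin 4) (Fin 4) (ZMod 2)) =
      φ (.a 1) * φ (.a 1) := by
    rw [← map_mul, ← hz']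
    rfl
  rw [hφz]
  refine Module.End.finrank_of_quaternion_relations (by simp) (B := φ (.xa 0)) ?_ ?_ ?_ ?_
  · simp only [← map_mul]
    rw [← map_one φ]
    exact congrArg φ (by decide)
  · simp only [← map_mul]
    exact congrArg φ (by decide)
  · simp only [← map_mul]
    exact congrArg φ (by decide)
  · rw [← map_mul, ← map_one φ]
    exact hφ.ne (by decide)
end

section
/- Let ρ : Q₈ → GL₄(𝔽₂) be an injective group homomorphism and let z be the unique element of order 2 of Q₈. Then for every x ∈ Q₈ with x ≠ 1, the image of the linear map ρ(z) − 1 on 𝔽₂⁴ is contained in the image of the linear map ρ(x) − 1; consequently, the image of ρ(z) − 1 equals the intersection over all x ≠ 1 in Q₈ of the images of ρ(x) − 1. -/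
/-- In `Q₈`, every nontrivial element either is a given involution or squares to it. -/
theorem QuaternionGroup.eq_or_mul_self_eq_of_orderOf_eq_two
    {z x : QuaternionGroup 2} (hz : orderOf z = 2) (hx : x ≠ 1) : x = z ∨ x * x = z := by
  have key : ∀ z x : QuaternionGroup 2,
      z * z = 1 → z ≠ 1 → x ≠ 1 → x = z ∨ x * x = z := by decide
  obtain ⟨hsq, hne⟩ := orderOf_eq_prime_iff.mp hz
  exact key z x (by rw [← sq, hsq]) hne hx

/-- The range of `A ^ 2 - 1` is contained in the range of `A - 1`. -/
theorem Matrix.range_mulVecLin_mul_self_sub_id_le {n R : Type*} [Fintype n] [CommRing R]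
    (A : Matrix n n R) :
    LinearMap.range ((A * A).mulVecLin - LinearMap.id) ≤
      LinearMap.range (A.mulVecLin - LinearMap.id) := by
  rintro _ ⟨v, rfl⟩
  exact ⟨A.mulVec v + v, by
    simp only [LinearMap.sub_apply, Matrix.mulVecLin_apply, LinearMap.id_apply,
      Matrix.mulVec_add, Matrix.mulVec_mulVec]
    abel⟩

/-- If `ρ : Q₈ → GL₄(𝔽₂)` is injective and `z` is the unique element of order 2 of `Q₈`,
then for every `x ≠ 1` in `Q₈` the image of `ρ(z) - 1` is contained in the image of
`ρ(x) - 1`; consequently the image of `ρ(z) - 1` is the intersection of the images of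
`ρ(x) - 1` over all `x ≠ 1`. -/
theorem range_of_involution_le
    (ρ : QuaternionGroup 2 →* GL (Fin 4) (ZMod 2)) (hρ : Function.Injective ρ)
    (z : QuaternionGroup 2) (hz : orderOf z = 2) :
    (∀ x : QuaternionGroup 2, x ≠ 1 →
      LinearMap.range (Matrix.mulVecLin (ρ z : Matrix (Fin 4) (Fin 4) (ZMod 2)) -
          LinearMap.id) ≤
        LinearMap.range (Matrix.mulVecLin (ρ x : Matrix (Fin 4) (Fin 4) (ZMod 2)) -
          LinearMap.id)) ∧
    LinearMap.range (Matrix.mulVecLin (ρ z : Matrix (Fin 4) (Fin 4) (ZMod 2)) -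
        LinearMap.id) =
      ⨅ x : {x : QuaternionGroup 2 // x ≠ 1},
        LinearMap.range (Matrix.mulVecLin (ρ x.1 : Matrix (Fin 4) (Fin 4) (ZMod 2)) -
          LinearMap.id) := by
  have hle : ∀ x : QuaternionGroup 2, x ≠ 1 →
      LinearMap.range (Matrix.mulVecLin (ρ z : Matrix (Fin 4) (Fin 4) (ZMod 2)) -
          LinearMap.id) ≤
        LinearMap.range (Matrix.mulVecLin (ρ x : Matrix (Fin 4) (Fin 4) (ZMod 2)) -
          LinearMap.id) := by
    intro x hx
    rcases QuaternionGroup.eq_or_mul_self_eq_of_orderOf_eq_two hz hx with rfl | rfl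
    · exact le_rfl
    · rw [map_mul, Units.val_mul]
      exact Matrix.range_mulVecLin_mul_self_sub_id_le _
  exact ⟨hle, le_antisymm (le_iInf fun x => hle x.1 x.2)
    (iInf_le_of_le ⟨z, (orderOf_eq_prime_iff.mp hz).2⟩ le_rfl)⟩
end

section
/- Let ρ : Q₈ → GL₄(𝔽₂) be an injective group homomorphism. Then there exists a nonzero 𝔽₂-linear functional f : 𝔽₂⁴ → 𝔽₂ such that for every x ∈ Q₈ with x ≠ 1, there exists v ∈ 𝔽₂⁴ with f(ρ(x)·v − v) ≠ 0; equivalently, the kernel of f is a hyperplane of 𝔽₂⁴ not containing the image of ρ(x) − 1 for any x ≠ 1. -/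
/-- Every nontrivial element of `Q₈` is the central involution or squares to it. -/
theorem QuaternionGroup.eq_or_mul_self_eq_of_ne_one :
    ∀ x : QuaternionGroup 2, x ≠ 1 → x = .a 2 ∨ x * x = .a 2 := by
  decide

/-- If `ρ : Q₈ → GL₄(𝔽₂)` is injective, then there is a nonzero linear functional
`f : 𝔽₂⁴ → 𝔽₂` whose kernel is a hyperplane containing none of the images of `ρ(x) - 1`
for `x ≠ 1`: for every `x ≠ 1` there is `v` with `f(ρ(x)·v - v) ≠ 0`. -/
theorem exists_hyperplane_avoiding_commutators
    (ρ : QuaternionGroup 2 →* GL (Fin 4) (ZMod 2)) (hρ : Function.Injective ρ) :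
    ∃ f : (Fin 4 → ZMod 2) →ₗ[ZMod 2] ZMod 2, f ≠ 0 ∧
      ∀ x : QuaternionGroup 2, x ≠ 1 →
        ∃ v : Fin 4 → ZMod 2,
          f ((ρ x : Matrix (Fin 4) (Fin 4) (ZMod 2)).mulVec v - v) ≠ 0 := by
  have hz : (QuaternionGroup.a 2 : QuaternionGroup 2) ≠ 1 := by decide
  -- It suffices that the central involution moves `f`, since a fixer of `f` has fixing powers.
  obtain ⟨v, i, hvi⟩ : ∃ v : Fin 4 → ZMod 2, ∃ i,
      (ρ (.a 2) : Matrix (Fin 4) (Fin 4) (ZMod 2)).mulVec v i ≠ v i := by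
    by_contra! h
    refine hz (hρ (Units.ext (Matrix.ext_of_mulVec_single fun j => ?_)))
    ext i
    rw [h, map_one, Units.val_one, Matrix.one_mulVec]
  refine ⟨LinearMap.proj i, fun h => hvi ?_, fun x hx => ?_⟩
  · have hf (w : Fin 4 → ZMod 2) : w i = 0 := LinearMap.congr_fun h w
    exact (hf _).trans (hf v).symm
  · by_contra! h
    have hfix (w : Fin 4 → ZMod 2) :
        (ρ x : Matrix (Fin 4) (Fin 4) (ZMod 2)).mulVec w i = w i :=
      sub_eq_zero.mp (h w)
    apply hvi
    rcases QuaternionGroup.eq_or_mul_self_eq_of_ne_one x hx with h2 | h2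
    · rw [← h2, hfix]
    · rw [← h2, map_mul, Units.val_mul, ← Matrix.mulVec_mulVec, hfix, hfix]
end

section
/- Let ρ : Q₈ → GL₄(𝔽₂) be an injective group homomorphism and let G = H ⋊_ρ Q₈ with H = (ℤ/2)⁴, a group of order 128. Then there exist an irreducible complex character χ of G with Frobenius–Schur indicator ν₂(χ) = +1 and an irreducible complex character φ of G with ν₂(φ) = −1 such that ⟨χ·χ, φ⟩ ≥ 1; indeed one may take χ induced from a suitable degree-one character of H and φ the inflation to G of the 2-dimensional irreducible character of Q₈ ≅ G/H. -/
open scoped ComplexOrder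

instance semidirectProductFintype {N G : Type*} [Group N] [Group G] (φ : G →* MulAut N)
    [Fintype N] [Fintype G] : Fintype (N ⋊[φ] G) :=
  Fintype.ofEquiv (N × G)
    { toFun := fun p => ⟨p.1, p.2⟩
      invFun := fun s => (s.left, s.right)
      left_inv := fun _ => rfl
      right_inv := fun _ => rfl }

namespace SemidirectProduct

variable {N Q : Type} [Group N] [Group Q] (φ : Q →* MulAut N) (μ : N →* ℂ)

lemma sum_eq_sum_sum [Fintype N] [Fintype Q] {M : Type*} [AddCommMonoid M] (f : N ⋊[φ] Q → M) :
    ∑ g, f g = ∑ q, ∑ h, f ⟨h, q⟩ := by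
  rw [Finset.sum_comm, ← Fintype.sum_prod_type']
  exact Fintype.sum_equiv SemidirectProduct.equivProd _ _ fun _ => rfl

lemma card_eq_mul [Fintype N] [Fintype Q] :
    Fintype.card (N ⋊[φ] Q) = Fintype.card N * Fintype.card Q := by
  rw [← Fintype.card_prod]
  exact Fintype.card_congr SemidirectProduct.equivProd

/-- The monomial matrices of the representation of `N ⋊[φ] Q` induced from the linear
character `μ` of `N`, with respect to the coset representatives `Q`. -/
def inducedMatrix [Fintype Q] [DecidableEq Q] : (N ⋊[φ] Q) →* Matrix Q Q ℂ where
  toFun g := Matrix.of fun x y => if y = g.right⁻¹ * x then μ (φ x⁻¹ g.left) else 0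
  map_one' := by
    ext x y
    simp [Matrix.one_apply, eq_comm]
  map_mul' g g' := by
    ext x y
    simp only [Matrix.of_apply, Matrix.mul_apply, ite_mul, zero_mul, Finset.sum_ite_eq',
      Finset.mem_univ, if_true]
    simp [mul_assoc]

/-- The sum of the conjugates of `μ` under the action of `Q`. -/
def orbitSum [Fintype Q] (h : N) : ℂ := ∑ x, μ (φ x h)

lemma trace_inducedMatrix [Fintype Q] [DecidableEq Q] (g : N ⋊[φ] Q) :
    (inducedMatrix φ μ g).trace = if g.right = 1 then orbitSum φ μ g.left else 0 := by
  by_cases hg : g.right = 1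
  · simpa [inducedMatrix, Matrix.trace, hg, orbitSum] using
      Equiv.sum_comp (Equiv.inv Q) fun x => μ (φ x g.left)
  · simp [inducedMatrix, Matrix.trace, hg]

variable {φ μ}

lemma sum_mul_conjugate_eq_zero [Fintype N] (hμ : ∀ h, μ h * μ h = 1)
    (hfree : ∀ q, (∀ h, μ (φ q h) = μ h) → q = 1) {p q : Q} (hpq : p ≠ q) :
    ∑ h, μ (φ p h) * μ (φ q h) = 0 := by
  refine sum_hom_units_eq_zero
    (μ.comp (φ p).toMonoidHom * μ.comp (φ q).toMonoidHom) fun h_one => hpq ?_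
  have key : ∀ h, μ (φ p h) * μ (φ q h) = 1 := fun h => DFunLike.congr_fun h_one h
  refine mul_inv_eq_one.mp (hfree (p * q⁻¹) fun h => ?_)
  have h₁ := key ((φ q)⁻¹ h)
  have h₂ := hμ h
  simp only [MulAut.apply_inv_self] at h₁
  simp only [map_mul, map_inv, MulAut.mul_apply]
  linear_combination μ h * h₁ - μ (φ p ((φ q)⁻¹ h)) * h₂

lemma sum_orbitSum_mul_self [Fintype N] [Fintype Q] (hμ : ∀ h, μ h * μ h = 1)
    (hfree : ∀ q, (∀ h, μ (φ q h) = μ h) → q = 1) :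
    ∑ h, orbitSum φ μ h * orbitSum φ μ h = Fintype.card N * Fintype.card Q := by
  classical
  have : ∀ p q : Q, ∑ h, μ (φ p h) * μ (φ q h) = if p = q then (Fintype.card N : ℂ) else 0 := by
    intro p q
    split_ifs with h
    · simp [h, hμ]
    · exact sum_mul_conjugate_eq_zero hμ hfree h
  simp_rw [orbitSum, Finset.sum_mul_sum]
  rw [Finset.sum_comm]
  simp_rw [Finset.sum_comm (s := (Finset.univ : Finset N)), this]
  simp [mul_comm]

lemma orbitSum_inv [Fintype Q] (hμ : ∀ h, μ h * μ h = 1) (h : N) :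
    orbitSum φ μ h⁻¹ = orbitSum φ μ h := by
  refine Finset.sum_congr rfl fun x _ => ?_
  have h₁ : μ (φ x h) * μ (φ x h⁻¹) = 1 := by rw [← map_mul, ← map_mul]; simp
  linear_combination μ (φ x h) * h₁ - μ (φ x h⁻¹) * hμ (φ x h)

lemma sum_trace_inducedMatrix_sq [Fintype N] [Fintype Q] [DecidableEq Q]
    (hμ : ∀ h, μ h * μ h = 1) (hfree : ∀ q, (∀ h, μ (φ q h) = μ h) → q = 1) :
    ∑ g : N ⋊[φ] Q, (inducedMatrix φ μ (g ^ 2)).trace = Fintype.card N * Fintype.card Q := by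
  rw [sum_eq_sum_sum, Finset.sum_eq_single 1]
  · simp only [trace_inducedMatrix, sq]
    simp [orbitSum, hμ]
  · intro q _ hq
    simp only [trace_inducedMatrix, sq, mul_right, mul_left]
    split_ifs
    · simp only [orbitSum, map_mul]
      rw [Finset.sum_comm]
      refine Finset.sum_eq_zero fun x _ => ?_
      simpa using sum_mul_conjugate_eq_zero hμ hfree (p := x) (q := x * q) (by simpa using hq)
    · simp
  · simp

lemma sum_trace_inducedMatrix_mul_inv [Fintype N] [Fintype Q] [DecidableEq Q]
    (hμ : ∀ h, μ h * μ h = 1) (hfree : ∀ q, (∀ h, μ (φ q h) = μ h) → q = 1) :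
    ∑ g : N ⋊[φ] Q, (inducedMatrix φ μ g).trace * (inducedMatrix φ μ g⁻¹).trace =
      Fintype.card N * Fintype.card Q := by
  rw [sum_eq_sum_sum, Finset.sum_eq_single 1]
  · simp only [trace_inducedMatrix]
    simpa [orbitSum_inv hμ] using sum_orbitSum_mul_self hμ hfree
  · intro q _ hq
    simp only [trace_inducedMatrix]
    simp [hq]
  · simp

lemma sum_trace_inducedMatrix_mul_self_mul [Fintype N] [Fintype Q] [DecidableEq Q]
    (hμ : ∀ h, μ h * μ h = 1) (hfree : ∀ q, (∀ h, μ (φ q h) = μ h) → q = 1) (f : Q → ℂ) :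
    ∑ g : N ⋊[φ] Q, (inducedMatrix φ μ g).trace * (inducedMatrix φ μ g).trace * f g.right =
      Fintype.card N * Fintype.card Q * f 1 := by
  rw [sum_eq_sum_sum, Finset.sum_eq_single 1]
  · simp only [trace_inducedMatrix]
    simp [← Finset.sum_mul, sum_orbitSum_mul_self hμ hfree]
  · intro q _ hq
    simp only [trace_inducedMatrix]
    simp [hq]
  · simp

end SemidirectProduct

namespace FDRep

variable {G n : Type} [Group G] [Fintype n] [DecidableEq n]

/-- The representation on column vectors given by a homomorphism to a matrix ring. -/
noncomputable def ofMatrix (M : G →* Matrix n n ℂ) : FDRep ℂ G :=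
  FDRep.of (V := n → ℂ) ((Matrix.toLinAlgEquiv' (R := ℂ) (n := n) : _ →* _).comp M)

lemma character_ofMatrix (M : G →* Matrix n n ℂ) (g : G) :
    (ofMatrix M).character g = (M g).trace :=
  Matrix.trace_toLin'_eq (M g)

end FDRep

namespace QuaternionGroup

lemma stdAddChar_two : ZMod.stdAddChar (2 : ZMod (2 * 2)) = -1 := by
  have h := ZMod.stdAddChar_coe (N := 2 * 2) 2
  rw [← Complex.exp_pi_mul_I]
  refine h.trans (congrArg _ ?_)
  push_cast
  ring

lemma xa_mul_xa_eq_a_two_add (i j : ZMod (2 * 2)) :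
    (xa i * xa j : QuaternionGroup 2) = a (2 + j - i) := rfl

/-- The two-dimensional irreducible complex representation of `Q₈`. -/
noncomputable def matrixRep : QuaternionGroup 2 →* Matrix (Fin 2) (Fin 2) ℂ where
  toFun
    | a i => !![ZMod.stdAddChar i, 0; 0, ZMod.stdAddChar (-i)]
    | xa i => !![0, -ZMod.stdAddChar (-i); ZMod.stdAddChar i, 0]
  map_one' := by
    change !![ZMod.stdAddChar (0 : ZMod (2 * 2)), 0; 0, ZMod.stdAddChar (-0 : ZMod (2 * 2))] = 1
    simp [Matrix.one_fin_two]
  map_mul' := by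
    rintro (i | i) (j | j)
    · simp [AddChar.map_add_eq_mul, add_comm]
    · simp [sub_eq_add_neg, AddChar.map_add_eq_mul, mul_comm]
    · simp [AddChar.map_add_eq_mul, add_comm]
    · have h_two : ZMod.stdAddChar (-2 : ZMod (2 * 2)) = -1 := stdAddChar_two
      simp only [xa_mul_xa_eq_a_two_add, sub_eq_add_neg, neg_add_rev, neg_neg,
        AddChar.map_add_eq_mul, stdAddChar_two, h_two]
      simp [mul_comm]

lemma trace_matrixRep_a (i : ZMod (2 * 2)) :
    (matrixRep (a i)).trace = ZMod.stdAddChar i + ZMod.stdAddChar (-i) := by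
  simp [matrixRep, Matrix.trace_fin_two]

lemma trace_matrixRep_xa (i : ZMod (2 * 2)) : (matrixRep (xa i)).trace = 0 := by
  simp [matrixRep, Matrix.trace_fin_two]

lemma sum_eq_sum_add_sum {M : Type*} [AddCommMonoid M] (f : QuaternionGroup 2 → M) :
    ∑ q, f q = ∑ i, f (a i) + ∑ i, f (xa i) := by
  refine Eq.trans ?_ (Fintype.sum_sum_type (Sum.elim (fun i => f (a i)) fun i => f (xa i)))
  refine Fintype.sum_bijective (fun q => match q with | a i => Sum.inl i | xa i => Sum.inr i)
    ⟨?_, ?_⟩ _ _ ?_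
  · rintro (i | i) (j | j) h <;> simp_all
  · rintro (i | i)
    · exact ⟨a i, rfl⟩
    · exact ⟨xa i, rfl⟩
  · rintro (i | i) <;> rfl

lemma sum_zmod_four (f : ZMod (2 * 2) → ℂ) : ∑ i, f i = f 0 + f 1 + f 2 + f 3 :=
  Fin.sum_univ_four f

lemma sum_trace_matrixRep_sq : ∑ q, (matrixRep (q ^ 2)).trace = -8 := by
  have h_two : ZMod.stdAddChar (-2 : ZMod (2 * 2)) = -1 := stdAddChar_two
  have e1 : (1 + 1 : ZMod (2 * 2)) = 2 := rfl
  have e2 : (2 + 2 : ZMod (2 * 2)) = 0 := rfl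
  have e3 : (3 + 3 : ZMod (2 * 2)) = 2 := rfl
  rw [sum_eq_sum_add_sum]
  simp only [sum_zmod_four, sq, a_mul_a, xa_mul_xa_eq_a_two_add, add_sub_cancel_right,
    trace_matrixRep_a, e1, e2, e3, stdAddChar_two, h_two]
  simp
  norm_num

lemma sum_trace_matrixRep_mul_inv :
    ∑ q, (matrixRep q).trace * (matrixRep q⁻¹).trace = 8 := by
  have h_two : ZMod.stdAddChar (-2 : ZMod (2 * 2)) = -1 := stdAddChar_two
  have h_three : ZMod.stdAddChar (3 : ZMod (2 * 2)) = - ZMod.stdAddChar (1 : ZMod (2 * 2)) := by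
    rw [show (3 : ZMod (2 * 2)) = 2 + 1 from rfl, AddChar.map_add_eq_mul, stdAddChar_two]
    ring
  have e1 : (-1 : ZMod (2 * 2)) = 3 := rfl
  have e3 : (-3 : ZMod (2 * 2)) = 1 := rfl
  have h_inv (i : ZMod (2 * 2)) : (a i : QuaternionGroup 2)⁻¹ = a (-i) := rfl
  rw [sum_eq_sum_add_sum]
  simp only [h_inv, trace_matrixRep_xa, zero_mul, sum_zmod_four, trace_matrixRep_a, neg_neg,
    h_two, e1, e3, h_three, stdAddChar_two]
  simp
  norm_num

lemma eq_or_sq_eq_of_ne_one : ∀ q : QuaternionGroup 2, q ≠ 1 → q = a 2 ∨ q ^ 2 = a 2 := by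
  decide

end QuaternionGroup

/-- The sign of the `i`-th coordinate, a linear character of `(ℤ/2)ⁿ`. -/
noncomputable def coordinateSign {ι : Type} (i : ι) : Multiplicative (ι → ZMod 2) →* ℂ where
  toFun v := if v.toAdd i = 0 then 1 else -1
  map_one' := by simp
  map_mul' v w := by
    have key : ∀ s t : ZMod 2, (if s + t = 0 then (1 : ℂ) else -1) =
        (if s = 0 then 1 else -1) * (if t = 0 then 1 else -1) := by
      intro s t
      have h : (1 + 1 : ZMod 2) = 0 := rfl
      have h_cases : ∀ s : ZMod 2, s = 0 ∨ s = 1 := by decide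
      rcases h_cases s with rfl | rfl <;> rcases h_cases t with rfl | rfl <;> simp [h]
    exact key _ _

lemma coordinateSign_mul_self {ι : Type} (i : ι) (v : Multiplicative (ι → ZMod 2)) :
    coordinateSign i v * coordinateSign i v = 1 := by
  simp only [coordinateSign, MonoidHom.coe_mk, OneHom.coe_mk]
  split_ifs <;> norm_num

lemma eq_of_coordinateSign_eq {ι : Type} {i : ι} {v w : Multiplicative (ι → ZMod 2)}
    (h : coordinateSign i v = coordinateSign i w) : v.toAdd i = w.toAdd i := by
  have key : ∀ s t : ZMod 2, (s = 0 ↔ t = 0) → s = t := by decide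
  refine key _ _ ?_
  simp only [coordinateSign, MonoidHom.coe_mk, OneHom.coe_mk] at h
  split_ifs at h with h₁ h₂ h₂
  · simp [h₁, h₂]
  · norm_num at h
  · norm_num at h
  · simp [h₁, h₂]

/-- Let `ρ : Q₈ → GL₄(𝔽₂)` be injective and `G = H ⋊_ρ Q₈` with `H = (ℤ/2)⁴`, a group of
order 128.  Then there are irreducible complex characters `χ`, `φ` of `G` with
`ν₂(χ) = +1`, `ν₂(φ) = -1` and `⟨χ·χ, φ⟩ ≥ 1`. -/
theorem semidirect_product_counterexample
    (ρ : QuaternionGroup 2 →* GL (Fin 4) (ZMod 2)) (hρ : Function.Injective ρ)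
    (φ : QuaternionGroup 2 →* MulAut (Multiplicative (Fin 4 → ZMod 2)))
    (hφ : ∀ (x : QuaternionGroup 2) (v : Fin 4 → ZMod 2),
      (φ x (Multiplicative.ofAdd v)).toAdd = (ρ x : Matrix (Fin 4) (Fin 4) (ZMod 2)).mulVec v) :
    Fintype.card (Multiplicative (Fin 4 → ZMod 2) ⋊[φ] QuaternionGroup 2) = 128 ∧
    ∃ V W : FDRep ℂ (Multiplicative (Fin 4 → ZMod 2) ⋊[φ] QuaternionGroup 2),
      CategoryTheory.Simple V ∧ CategoryTheory.Simple W ∧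
      -- ν₂(χ) = +1
      (Fintype.card (Multiplicative (Fin 4 → ZMod 2) ⋊[φ] QuaternionGroup 2) : ℂ)⁻¹ *
        (∑ g : Multiplicative (Fin 4 → ZMod 2) ⋊[φ] QuaternionGroup 2,
          V.character (g ^ 2)) = 1 ∧
      -- ν₂(φ) = -1
      (Fintype.card (Multiplicative (Fin 4 → ZMod 2) ⋊[φ] QuaternionGroup 2) : ℂ)⁻¹ *
        (∑ g : Multiplicative (Fin 4 → ZMod 2) ⋊[φ] QuaternionGroup 2,
          W.character (g ^ 2)) = -1 ∧
      -- ⟨χ·χ, φ⟩ ≥ 1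
      1 ≤ (Fintype.card (Multiplicative (Fin 4 → ZMod 2) ⋊[φ] QuaternionGroup 2) : ℂ)⁻¹ *
        ∑ g : Multiplicative (Fin 4 → ZMod 2) ⋊[φ] QuaternionGroup 2,
          V.character g * V.character g * (starRingEnd ℂ) (W.character g) := by
  obtain ⟨i, hfree⟩ : ∃ i, ∀ q, (∀ h, coordinateSign i (φ q h) = coordinateSign i h) → q = 1 := by
    have hz : ρ (QuaternionGroup.a 2) ≠ 1 := by
      rw [← map_one ρ]
      exact hρ.ne (by decide)
    obtain ⟨v, hv⟩ : ∃ v, (ρ (QuaternionGroup.a 2) : Matrix (Fin 4) (Fin 4) (ZMod 2)).mulVec v ≠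
        v := by
      by_contra! h
      exact hz (Units.ext (Matrix.ext_of_mulVec_single fun i =>
        (h _).trans (Matrix.one_mulVec _).symm))
    obtain ⟨i, hi⟩ := Function.ne_iff.mp hv
    have hz_moves : ¬ ∀ h, coordinateSign i (φ (QuaternionGroup.a 2) h) = coordinateSign i h := by
      intro h
      apply hi
      rw [← hφ]
      exact eq_of_coordinateSign_eq (h (Multiplicative.ofAdd v))
    refine ⟨i, fun q hq => ?_⟩
    by_contra h
    rcases QuaternionGroup.eq_or_sq_eq_of_ne_one q h with rfl | h
    · exact hz_moves hq
    · refine hz_moves fun v => ?_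
      rw [← h, sq, map_mul, MulAut.mul_apply, hq, hq]
  have hμ := coordinateSign_mul_self i
  have cN : Fintype.card (Multiplicative (Fin 4 → ZMod 2)) = 16 := by simp
  have cQ : Fintype.card (QuaternionGroup 2) = 8 := by simp [QuaternionGroup.card]
  have cG : Fintype.card (Multiplicative (Fin 4 → ZMod 2) ⋊[φ] QuaternionGroup 2) = 128 := by
    rw [SemidirectProduct.card_eq_mul, cN, cQ]
  refine ⟨cG, FDRep.ofMatrix (SemidirectProduct.inducedMatrix φ (coordinateSign i)),
    FDRep.ofMatrix (QuaternionGroup.matrixRep.comp SemidirectProduct.rightHom), ?_, ?_, ?_, ?_, ?_⟩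
  · rw [FDRep.simple_iff_char_is_norm_one]
    simp only [FDRep.character_ofMatrix]
    rw [SemidirectProduct.sum_trace_inducedMatrix_mul_inv hμ hfree, Nat.card_eq_fintype_card,
      SemidirectProduct.card_eq_mul, Nat.cast_mul]
  · rw [FDRep.simple_iff_char_is_norm_one]
    simp only [FDRep.character_ofMatrix, SemidirectProduct.sum_eq_sum_sum, MonoidHom.comp_apply,
      SemidirectProduct.rightHom_eq_right, SemidirectProduct.inv_right, Finset.sum_const,
      Finset.card_univ, cN]
    rw [← Finset.smul_sum, QuaternionGroup.sum_trace_matrixRep_mul_inv, Nat.card_eq_fintype_card,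
      cG]
    norm_num
  · simp only [FDRep.character_ofMatrix]
    rw [SemidirectProduct.sum_trace_inducedMatrix_sq hμ hfree, cG, cN, cQ]
    norm_num
  · simp only [FDRep.character_ofMatrix, SemidirectProduct.sum_eq_sum_sum, MonoidHom.comp_apply,
      map_pow, SemidirectProduct.rightHom_eq_right, Finset.sum_const, Finset.card_univ, cN]
    simp only [← map_pow]
    rw [← Finset.smul_sum, QuaternionGroup.sum_trace_matrixRep_sq, cG]
    norm_num
  · simp only [FDRep.character_ofMatrix]
    have h := SemidirectProduct.sum_trace_inducedMatrix_mul_self_mul hμ hfree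
      fun q => starRingEnd ℂ (QuaternionGroup.matrixRep q).trace
    simp only [MonoidHom.comp_apply, SemidirectProduct.rightHom_eq_right]
    rw [h, cG, cN, cQ]
    norm_num [map_ofNat (starRingEnd ℂ) 2]
end
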